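/- Let G = GSp₄, M ≅ GL₁ × GL₂ a proper Levi containing T, s ∈ W_M the nontrivial reflection, and w^M ∈ W^M. Then (w^M)⁻¹ t_η s w^M lies in (w^M)⁻¹ Adm_M(η) w^M ⊂ Adm(η), and is the unique element of (w^M)⁻¹ Adm_M(η) w^M not contained in (w^M)⁻¹ Adm_T(η) w^M ∪ (s w^M)⁻¹ Adm_T(η) (s w^M), where Adm_T(η) = {t_{w(η)} : w ∈ W} is the set of translations by Weyl conjugates of η. -/

import Mathlib

/-!
Extended affine Weyl group combinatorics, modeled concretely: the extended affine Weyl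
group acts by affine transformations on `V = X^*(T) ⊗ ℝ`; the length of an element is the
number of affine root hyperplanes separating the (dominant) base alcove from its image,
and the Bruhat order is generated by multiplication by affine reflections increasing length.
-/

open scoped Pointwise

namespace AffWeyl

/-- Root datum data: `ι` indexes the positive roots; `root i ∈ V` is the root and
`coroot i = ⟨·, α_i^∨⟩` the pairing with its coroot; `lattice` is the character lattice
`X^*(T) ⊂ V`; `simple ⊆ ι` indexes the simple roots. -/
structure Data (V : Type*) [AddCommGroup V] [Module ℝ V] (ι : Type*) where
  root : ι → V
  coroot : ι → V →ₗ[ℝ] ℝ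
  lattice : AddSubgroup V
  simple : Set ι

variable {V : Type*} [AddCommGroup V] [Module ℝ V] {ι : Type*} [Fintype ι]

/-- The (dominant) base alcove of the Levi whose positive roots are indexed by `I`. -/
def Data.alcove (D : Data V ι) (I : Set ι) : Set V :=
  {x | ∀ i ∈ I, 0 < D.coroot i x ∧ D.coroot i x < 1}

/-- Translation `t_v` as an affine transformation of `V`. -/
def tr (v : V) : V ≃ᵃ[ℝ] V := AffineEquiv.constVAdd ℝ V v

/-- `r` is an affine reflection `s_α t_{mα}` for a root `α` of the Levi indexed by `I`,
i.e. `r x = x - (⟨x, α^∨⟩ - m) α`. -/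
def Data.IsAffRefl (D : Data V ι) (I : Set ι) (r : V ≃ᵃ[ℝ] V) : Prop :=
  ∃ i ∈ I, ∃ m : ℤ, ∀ x, r x = x - (D.coroot i x - m) • D.root i

/-- The hyperplane `⟨·, α^∨⟩ = k` separates the sets `A` and `B`. -/
def Separates (f : V →ₗ[ℝ] ℝ) (k : ℤ) (A B : Set V) : Prop :=
  ((∀ x ∈ A, f x < k) ∧ (∀ x ∈ B, (k : ℝ) < f x)) ∨
    ((∀ x ∈ A, (k : ℝ) < f x) ∧ (∀ x ∈ B, f x < k))

/-- Length of `g` (for the Levi indexed by `I`): the number of affine root hyperplanes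
separating the base alcove from its image under `g`. -/
noncomputable def Data.len (D : Data V ι) (I : Set ι) (g : V ≃ᵃ[ℝ] V) : ℕ :=
  Nat.card {p : ι × ℤ | p.1 ∈ I ∧
    Separates (D.coroot p.1) p.2 (D.alcove I) (⇑g '' D.alcove I)}

/-- The finite Weyl group of the Levi indexed by `I`: generated by the (linear)
reflections `s_α`, `α` a root of the Levi. -/
def Data.finW (D : Data V ι) (I : Set ι) : Subgroup (V ≃ᵃ[ℝ] V) :=
  Subgroup.closure {r | ∃ i ∈ I, ∀ x, r x = x - D.coroot i x • D.root i}

/-- The extended affine Weyl group of the Levi indexed by `I`: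
`W̃_M = X^*(T) ⋊ W_M`, generated by lattice translations and finite reflections. -/
def Data.extW (D : Data V ι) (I : Set ι) : Subgroup (V ≃ᵃ[ℝ] V) :=
  D.finW I ⊔ Subgroup.closure ((fun v => tr v) '' (D.lattice : Set V))

/-- `w` is a minimal length coset representative in `W^M`:
`w ∈ W` and `ℓ(s_α w) > ℓ(w)` for every simple root `α` of the Levi `M`. -/
def Data.IsMinRep (D : Data V ι) (I : Set ι) (w : V ≃ᵃ[ℝ] V) : Prop :=
  w ∈ D.finW Set.univ ∧
    ∀ i ∈ D.simple ∩ I, ∀ s : V ≃ᵃ[ℝ] V,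
      (∀ x, s x = x - D.coroot i x • D.root i) →
        D.len Set.univ w < D.len Set.univ (s * w)

/-- Bruhat order on the extended affine Weyl group of the Levi indexed by `I`. -/
def Data.bruhatLE (D : Data V ι) (I : Set ι) : (V ≃ᵃ[ℝ] V) → (V ≃ᵃ[ℝ] V) → Prop :=
  Relation.ReflTransGen fun a b =>
    ∃ r, D.IsAffRefl I r ∧ b = r * a ∧ D.len I a < D.len I b

/-- The admissible set `Adm_M(λ) = {w̃ : w̃ ≤ t_{w(λ)} for some w ∈ W_M}`. -/
def Data.adm (D : Data V ι) (I : Set ι) (lam : V) : Set (V ≃ᵃ[ℝ] V) :=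
  {z | ∃ w ∈ D.finW I, D.bruhatLE I z (tr (w lam))}

end AffWeyl

open AffWeyl

namespace GSp4

/-- The four positive coroots of `GSp₄`, pairing `(a,b;c)` to `a−b, b, a, a+b`. -/
noncomputable def cr : Fin 4 → (Fin 3 → ℝ) →ₗ[ℝ] ℝ :=
  ![(LinearMap.proj 0 : (Fin 3 → ℝ) →ₗ[ℝ] ℝ) - LinearMap.proj 1,
    (LinearMap.proj 1 : (Fin 3 → ℝ) →ₗ[ℝ] ℝ),
    (LinearMap.proj 0 : (Fin 3 → ℝ) →ₗ[ℝ] ℝ),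
    (LinearMap.proj 0 : (Fin 3 → ℝ) →ₗ[ℝ] ℝ) + LinearMap.proj 1]

/-- The four positive roots of `GSp₄` in `X^*(T) ⊗ ℝ ≅ ℝ³`:
`α₁ = (1,−1;0)`, `α₂ = (0,2;−1)`, `2α₁+α₂ = (2,0;−1)`, `α₁+α₂ = (1,1;−1)`. -/
noncomputable def rt : Fin 4 → (Fin 3 → ℝ) :=
  ![![1, -1, 0], ![0, 2, -1], ![2, 0, -1], ![1, 1, -1]]

/-- The character lattice `X^*(T) ≅ ℤ³ ⊆ ℝ³`. -/
def intLat : AddSubgroup (Fin 3 → ℝ) where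
  carrier := {x | ∀ j, ∃ n : ℤ, x j = n}
  zero_mem' := fun j => ⟨0, by simp⟩
  add_mem' := by
    intro a b ha hb j
    obtain ⟨n, hn⟩ := ha j
    obtain ⟨m, hm⟩ := hb j
    exact ⟨n + m, by simp [hn, hm]⟩
  neg_mem' := by
    intro a ha j
    obtain ⟨n, hn⟩ := ha j
    exact ⟨-n, by simp [hn]⟩

/-- The affine Weyl group data for `GSp₄`; the simple roots are `α₁, α₂`. -/
noncomputable def D : Data (Fin 3 → ℝ) (Fin 4) where
  root := rt
  coroot := cr
  lattice := intLat
  simple := {0, 1}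

/-- `η = (2,1;0)`. -/
noncomputable def eta : Fin 3 → ℝ := ![2, 1, 0]

end GSp4

open GSp4

namespace AffWeyl

variable {V : Type*} [AddCommGroup V] [Module ℝ V] {ι : Type*} [Fintype ι]

@[simp] lemma tr_apply (v x : V) : tr v x = v + x := rfl

lemma card_crossed (n : ℤ) :
    Nat.card {k : ℤ // (1 ≤ k ∧ k ≤ n) ∨ (n + 1 ≤ k ∧ k ≤ 0)} = n.natAbs := by
  have h : ∀ k : ℤ, k ∈ Finset.Icc 1 n ∪ Finset.Icc (n + 1) 0 ↔
      (1 ≤ k ∧ k ≤ n) ∨ (n + 1 ≤ k ∧ k ≤ 0) := by simp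
  rw [Nat.subtype_card _ h, Finset.card_union_of_disjoint]
  · simp only [Int.card_Icc]; omega
  · rw [Finset.disjoint_left]
    intro k; simp only [Finset.mem_Icc]; omega

/-- If `f` takes values in `(0, 1)` on `A` and in `(n, n + 1)` on `B`, the hyperplanes `f = k`
separating `A` from `B` are those with `1 ≤ k ≤ n` or `n + 1 ≤ k ≤ 0`. -/
lemma separates_iff {f : V →ₗ[ℝ] ℝ} {k n : ℤ} {A B : Set V} (hA : A.Nonempty) (hB : B.Nonempty)
    (hfA : ∀ x ∈ A, 0 < f x ∧ f x < 1) (hfB : ∀ x ∈ B, (n : ℝ) < f x ∧ f x < n + 1) :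
    Separates f k A B ↔ (1 ≤ k ∧ k ≤ n) ∨ (n + 1 ≤ k ∧ k ≤ 0) := by
  obtain ⟨a, ha⟩ := hA
  obtain ⟨b, hb⟩ := hB
  constructor
  · rintro (⟨h1, h2⟩ | ⟨h1, h2⟩)
    · left
      have e1 : ((0 : ℤ) : ℝ) < k := by push_cast; linarith [h1 a ha, (hfA a ha).1]
      have e2 : (k : ℝ) < ((n + 1 : ℤ) : ℝ) := by push_cast; linarith [h2 b hb, (hfB b hb).2]
      have e1 := Int.cast_lt.1 e1
      have e2 := Int.cast_lt.1 e2
      omega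
    · right
      have e1 : (k : ℝ) < ((1 : ℤ) : ℝ) := by push_cast; linarith [h1 a ha, (hfA a ha).2]
      have e2 : (n : ℝ) < k := by linarith [h2 b hb, (hfB b hb).1]
      have e1 := Int.cast_lt.1 e1
      have e2 := Int.cast_lt.1 e2
      omega
  · rintro (⟨h1, h2⟩ | ⟨h1, h2⟩)
    · have h1 : (1 : ℝ) ≤ k := by exact_mod_cast h1
      have h2 : (k : ℝ) ≤ n := by exact_mod_cast h2
      exact Or.inl ⟨fun x hx => by linarith [(hfA x hx).2], fun x hx => by linarith [(hfB x hx).1]⟩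
    · have h1 : (n : ℝ) + 1 ≤ k := by exact_mod_cast h1
      have h2 : (k : ℝ) ≤ 0 := by exact_mod_cast h2
      exact Or.inr ⟨fun x hx => by linarith [(hfA x hx).1], fun x hx => by linarith [(hfB x hx).2]⟩

open Classical in
/-- The length formula: if the image of the base alcove under `g` lies between the hyperplanes
`α_j^∨ = n_j` and `α_j^∨ = n_j + 1`, then `ℓ(g) = ∑ |n_j|`. -/
lemma Data.len_eq (D : Data V ι) (I : Set ι) (g : V ≃ᵃ[ℝ] V) (hne : (D.alcove I).Nonempty)
    (n : ι → ℤ) (h : ∀ x ∈ D.alcove I, ∀ j ∈ I,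
      (n j : ℝ) < D.coroot j (g x) ∧ D.coroot j (g x) < n j + 1) :
    D.len I g = ∑ j, if j ∈ I then (n j).natAbs else 0 := by
  have key : ∀ j ∈ I, ∀ k : ℤ, Separates (D.coroot j) k (D.alcove I) (⇑g '' D.alcove I) ↔
      (1 ≤ k ∧ k ≤ n j) ∨ (n j + 1 ≤ k ∧ k ≤ 0) := fun j hj k =>
    separates_iff hne (hne.image _) (fun x hx => hx j hj)
      (by rintro _ ⟨x, hx, rfl⟩; exact h x hx j hj)
  let T : ι → Type := fun j =>
    {k : ℤ // j ∈ I ∧ ((1 ≤ k ∧ k ≤ n j) ∨ (n j + 1 ≤ k ∧ k ≤ 0))}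
  have hT : ∀ j, Finite (T j) := fun j => by
    refine Set.Finite.subset (Set.finite_Icc (min 1 (n j)) (max 1 (n j))) ?_
    rintro k ⟨-, hk⟩
    simp only [Set.mem_Icc]
    omega
  let e : {p : ι × ℤ | p.1 ∈ I ∧
      Separates (D.coroot p.1) p.2 (D.alcove I) (⇑g '' D.alcove I)} ≃ Σ j, T j :=
    { toFun := fun p => ⟨p.1.1, p.1.2, p.2.1, (key _ p.2.1 _).1 p.2.2⟩
      invFun := fun q => ⟨(q.1, q.2.1), q.2.2.1, (key _ q.2.2.1 _).2 q.2.2.2⟩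
      left_inv := fun _ => rfl
      right_inv := fun _ => rfl }
  rw [Data.len, Nat.card_congr e, Nat.card_sigma]
  refine Finset.sum_congr rfl fun j _ => ?_
  split_ifs with hj
  · rw [← card_crossed]
    exact Nat.card_congr (Equiv.subtypeEquivRight fun k => by simp [hj])
  · have : IsEmpty (T j) := ⟨fun k => hj k.2.1⟩
    exact Nat.card_of_isEmpty

end AffWeyl

namespace GSp4

@[simp] lemma cr_zero (x : Fin 3 → ℝ) : cr 0 x = x 0 - x 1 := rfl
@[simp] lemma cr_one (x : Fin 3 → ℝ) : cr 1 x = x 1 := rfl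
@[simp] lemma cr_two (x : Fin 3 → ℝ) : cr 2 x = x 0 := rfl
@[simp] lemma cr_three (x : Fin 3 → ℝ) : cr 3 x = x 0 + x 1 := rfl

lemma alcove_nonempty (I : Set (Fin 4)) : (D.alcove I).Nonempty := by
  refine ⟨![1 / 2, 1 / 4, 0], fun j _ => ?_⟩
  change 0 < cr j _ ∧ cr j _ < 1
  fin_cases j <;> simp <;> norm_num

lemma len_singleton (i : Fin 4) (g : (Fin 3 → ℝ) ≃ᵃ[ℝ] (Fin 3 → ℝ)) (n : ℤ)
    (h : ∀ x, 0 < cr i x → cr i x < 1 → (n : ℝ) < cr i (g x) ∧ cr i (g x) < n + 1) :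
    D.len {i} g = n.natAbs := by
  rw [D.len_eq {i} g (alcove_nonempty _) (fun _ => n)]
  · simp
  · rintro x hx _ rfl
    exact h x (hx _ rfl).1 (hx _ rfl).2

lemma len_univ (g : (Fin 3 → ℝ) ≃ᵃ[ℝ] (Fin 3 → ℝ)) (n : Fin 4 → ℤ)
    (h : ∀ x : Fin 3 → ℝ, 0 < x 1 → x 1 < x 0 → x 0 + x 1 < 1 →
      ∀ j, (n j : ℝ) < cr j (g x) ∧ cr j (g x) < n j + 1) :
    D.len Set.univ g =
      (n 0).natAbs + (n 1).natAbs + (n 2).natAbs + (n 3).natAbs := by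
  rw [D.len_eq Set.univ g (alcove_nonempty _) n]
  · simp [Fin.sum_univ_four]
  · intro x hx j _
    have h0 : 0 < x 0 - x 1 := (hx 0 trivial).1
    have h1 : 0 < x 1 := (hx 1 trivial).1
    have h3 : x 0 + x 1 < 1 := (hx 3 trivial).2
    exact h x h1 (by linarith) h3 j

/-- Length of `(a, b; c) ↦ (p ± a, q ± b; ⋯)`, with signs `1 + 2 d₁`, `1 + 2 d₂`. -/
lemma len_diag (g : (Fin 3 → ℝ) ≃ᵃ[ℝ] (Fin 3 → ℝ)) (p q d₁ d₂ : ℤ)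
    (h₁ : d₁ = 0 ∨ d₁ = -1) (h₂ : d₂ = 0 ∨ d₂ = -1)
    (hg : ∀ x, g x 0 = p + (1 + 2 * d₁) * x 0 ∧ g x 1 = q + (1 + 2 * d₂) * x 1) :
    D.len Set.univ g = (p - q + d₁).natAbs + (q + d₂).natAbs + (p + d₁).natAbs +
      (p + q + d₁).natAbs := by
  refine len_univ g ![p - q + d₁, q + d₂, p + d₁, p + q + d₁] fun x h0 h1 h3 j => ?_
  rcases h₁ with rfl | rfl <;> rcases h₂ with rfl | rfl <;> fin_cases j <;>
    simp [hg] <;> constructor <;> linarith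

/-- Length of `(a, b; c) ↦ (p ± b, q ± a; ⋯)`, with signs `1 + 2 d₁`, `1 + 2 d₂`. -/
lemma len_swap (g : (Fin 3 → ℝ) ≃ᵃ[ℝ] (Fin 3 → ℝ)) (p q d₁ d₂ : ℤ)
    (h₁ : d₁ = 0 ∨ d₁ = -1) (h₂ : d₂ = 0 ∨ d₂ = -1)
    (hg : ∀ x, g x 0 = p + (1 + 2 * d₁) * x 1 ∧ g x 1 = q + (1 + 2 * d₂) * x 0) :
    D.len Set.univ g = (p - q - 1 - d₂).natAbs + (q + d₂).natAbs + (p + d₁).natAbs +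
      (p + q + d₂).natAbs := by
  refine len_univ g ![p - q - 1 - d₂, q + d₂, p + d₁, p + q + d₂] fun x h0 h1 h3 j => ?_
  rcases h₁ with rfl | rfl <;> rcases h₂ with rfl | rfl <;> fin_cases j <;>
    simp [hg] <;> constructor <;> linarith

/-- `w` is `(a, b; c) ↦ (± a, ± b; c - d₁ a - d₂ b)`, with signs `1 + 2 d₁`, `1 + 2 d₂`. -/
def IsDiag (w : (Fin 3 → ℝ) ≃ᵃ[ℝ] (Fin 3 → ℝ)) (d₁ d₂ : ℤ) : Prop :=
  (d₁ = 0 ∨ d₁ = -1) ∧ (d₂ = 0 ∨ d₂ = -1) ∧ ∀ x : Fin 3 → ℝ,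
    w x = ![(1 + 2 * d₁) * x 0, (1 + 2 * d₂) * x 1, x 2 - d₁ * x 0 - d₂ * x 1]

/-- `w` is `(a, b; c) ↦ (± b, ± a; c - d₁ b - d₂ a)`, with signs `1 + 2 d₁`, `1 + 2 d₂`. -/
def IsSwap (w : (Fin 3 → ℝ) ≃ᵃ[ℝ] (Fin 3 → ℝ)) (d₁ d₂ : ℤ) : Prop :=
  (d₁ = 0 ∨ d₁ = -1) ∧ (d₂ = 0 ∨ d₂ = -1) ∧ ∀ x : Fin 3 → ℝ,
    w x = ![(1 + 2 * d₁) * x 1, (1 + 2 * d₂) * x 0, x 2 - d₁ * x 1 - d₂ * x 0]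

lemma cr_rt_self (j : Fin 4) : cr j (rt j) = 2 := by
  fin_cases j <;> simp [rt] <;> norm_num

lemma affRefl_mul_self {r : (Fin 3 → ℝ) ≃ᵃ[ℝ] (Fin 3 → ℝ)} {j : Fin 4} {m : ℝ}
    (hr : ∀ x, r x = x - (cr j x - m) • rt j) : r * r = 1 := by
  refine AffineEquiv.ext fun x => ?_
  change r (r x) = x
  simp only [hr, map_sub, map_smul, cr_rt_self, smul_eq_mul]
  module

lemma refl_mul_self {r : (Fin 3 → ℝ) ≃ᵃ[ℝ] (Fin 3 → ℝ)} {j : Fin 4}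
    (hr : ∀ x, r x = x - cr j x • rt j) : r * r = 1 :=
  affRefl_mul_self (j := j) (m := 0) (by simpa using hr)

lemma exists_isDiag_or_isSwap_refl_mul {r w : (Fin 3 → ℝ) ≃ᵃ[ℝ] (Fin 3 → ℝ)} {j : Fin 4}
    (hr : ∀ x, r x = x - cr j x • rt j) (hw : ∃ d₁ d₂, IsDiag w d₁ d₂ ∨ IsSwap w d₁ d₂) :
    ∃ d₁ d₂, IsDiag (r * w) d₁ d₂ ∨ IsSwap (r * w) d₁ d₂ := by
  obtain ⟨d₁, d₂, h⟩ := hw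
  have hrw : ∀ x, (r * w) x = w x - cr j (w x) • rt j := fun x => hr (w x)
  simp only [IsDiag, IsSwap, hrw] at h ⊢
  fin_cases j
  · refine ⟨d₂, d₁, h.symm.imp ?_ ?_⟩ <;>
    · rintro ⟨h₁, h₂, h⟩
      refine ⟨h₂, h₁, fun x => ?_⟩
      ext k
      fin_cases k <;> simp [h, rt]; ring
  · refine ⟨d₁, -1 - d₂, h.imp ?_ ?_⟩ <;>
    · rintro ⟨h₁, h₂, h⟩
      refine ⟨h₁, by omega, fun x => ?_⟩
      ext k
      fin_cases k <;> simp [h, rt] <;> ring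
  · refine ⟨-1 - d₁, d₂, h.imp ?_ ?_⟩ <;>
    · rintro ⟨h₁, h₂, h⟩
      refine ⟨by omega, h₂, fun x => ?_⟩
      ext k
      fin_cases k <;> simp [h, rt] <;> ring
  · refine ⟨-1 - d₂, -1 - d₁, h.symm.imp ?_ ?_⟩ <;>
    · rintro ⟨h₁, h₂, h⟩
      refine ⟨by omega, by omega, fun x => ?_⟩
      ext k
      fin_cases k <;> simp [h, rt] <;> ring

/-- Every element of the finite Weyl group is a signed permutation of the first two
coordinates. -/
lemma finW_cases {w : (Fin 3 → ℝ) ≃ᵃ[ℝ] (Fin 3 → ℝ)} (hw : w ∈ D.finW Set.univ) :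
    ∃ d₁ d₂, IsDiag w d₁ d₂ ∨ IsSwap w d₁ d₂ := by
  refine Subgroup.closure_induction_left
    (p := fun w _ => ∃ d₁ d₂, IsDiag w d₁ d₂ ∨ IsSwap w d₁ d₂) ?_ ?_ ?_ hw
  · refine ⟨0, 0, Or.inl ⟨Or.inl rfl, Or.inl rfl, fun x => ?_⟩⟩
    ext k
    fin_cases k <;> simp
  · rintro r ⟨j, -, hr⟩ w - h
    exact exists_isDiag_or_isSwap_refl_mul hr h
  · rintro r ⟨j, -, hr⟩ w - h
    rw [inv_eq_of_mul_eq_one_left (refl_mul_self hr)]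
    exact exists_isDiag_or_isSwap_refl_mul hr h

lemma finW_singleton {i : Fin 4} {s w : (Fin 3 → ℝ) ≃ᵃ[ℝ] (Fin 3 → ℝ)}
    (hs : ∀ x, s x = x - cr i x • rt i) (hw : w ∈ D.finW {i}) : w = 1 ∨ w = s := by
  have hss := refl_mul_self hs
  have hr : ∀ r : (Fin 3 → ℝ) ≃ᵃ[ℝ] (Fin 3 → ℝ), (∃ j ∈ ({i} : Set (Fin 4)),
      ∀ x, r x = x - D.coroot j x • D.root j) → r = s := by
    rintro r ⟨_, rfl, h⟩
    exact AffineEquiv.ext fun x => (h x).trans (hs x).symm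
  refine Subgroup.closure_induction_left (p := fun w _ => w = 1 ∨ w = s) (Or.inl rfl) ?_ ?_ hw
  · rintro r h w - (rfl | rfl)
    · exact Or.inr (by rw [hr r h, mul_one])
    · exact Or.inl (by rw [hr r h, hss])
  · rintro r h w - (rfl | rfl)
    · exact Or.inr (by rw [hr r h, inv_eq_of_mul_eq_one_left hss, mul_one])
    · exact Or.inl (by rw [hr r h, inv_mul_cancel])

lemma refl_mem_finW {i : Fin 4} {s : (Fin 3 → ℝ) ≃ᵃ[ℝ] (Fin 3 → ℝ)}
    (hs : ∀ x, s x = x - cr i x • rt i) (I : Set (Fin 4)) (hi : i ∈ I) : s ∈ D.finW I :=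
  Subgroup.subset_closure ⟨i, hi, hs⟩

lemma IsDiag.inv {w : (Fin 3 → ℝ) ≃ᵃ[ℝ] (Fin 3 → ℝ)} {d₁ d₂ : ℤ} (h : IsDiag w d₁ d₂) :
    IsDiag w⁻¹ d₁ d₂ := by
  obtain ⟨h₁, h₂, hw⟩ := h
  refine ⟨h₁, h₂, fun x => ?_⟩
  change w.symm x = _
  rw [AffineEquiv.symm_apply_eq, hw]
  ext k
  rcases h₁ with rfl | rfl <;> rcases h₂ with rfl | rfl <;> fin_cases k <;> simp <;> ring

lemma IsSwap.inv {w : (Fin 3 → ℝ) ≃ᵃ[ℝ] (Fin 3 → ℝ)} {d₁ d₂ : ℤ} (h : IsSwap w d₁ d₂) :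
    IsSwap w⁻¹ d₂ d₁ := by
  obtain ⟨h₁, h₂, hw⟩ := h
  refine ⟨h₂, h₁, fun x => ?_⟩
  change w.symm x = _
  rw [AffineEquiv.symm_apply_eq, hw]
  ext k
  rcases h₁ with rfl | rfl <;> rcases h₂ with rfl | rfl <;> fin_cases k <;> simp <;> ring

lemma finW_add_smul {w : (Fin 3 → ℝ) ≃ᵃ[ℝ] (Fin 3 → ℝ)} (hw : w ∈ D.finW Set.univ)
    (c : ℝ) (x y : Fin 3 → ℝ) : w (x + c • y) = w x + c • w y := by
  obtain ⟨d₁, d₂, ⟨-, -, h⟩ | ⟨-, -, h⟩⟩ := finW_cases hw <;>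
  · ext k
    fin_cases k <;> simp [h] <;> ring

lemma conj_tr {w : (Fin 3 → ℝ) ≃ᵃ[ℝ] (Fin 3 → ℝ)} (hw : w ∈ D.finW Set.univ)
    (v : Fin 3 → ℝ) : w⁻¹ * tr v * w = tr (w⁻¹ v) := by
  rw [mul_assoc, inv_mul_eq_iff_eq_mul]
  refine AffineEquiv.ext fun x => ?_
  change v + w x = w (w⁻¹ v + x)
  have h := finW_add_smul hw 1 (w⁻¹ v) x
  rw [one_smul, one_smul] at h
  rw [h]
  exact congrArg (· + w x) (w.apply_symm_apply v).symm

/-- If `w` sends the positive root `α_j` to `α_i`, then `w⁻¹ t_η s_i w` is obtained from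
`t_{w⁻¹ η}` by the reflection in the hyperplane `α_j^∨ = 1`. -/
lemma conj_mem_adm {w s : (Fin 3 → ℝ) ≃ᵃ[ℝ] (Fin 3 → ℝ)} {i j : Fin 4}
    (hw : w ∈ D.finW Set.univ) (hs : ∀ x, s x = x - cr i x • rt i) (hη : cr i eta = 1)
    (hcr : ∀ x, cr i (w x) = cr j x) (hrt : w (rt j) = rt i)
    (hlen : D.len Set.univ (w⁻¹ * (tr eta * s) * w) < D.len Set.univ (tr (w⁻¹ eta))) :
    w⁻¹ * (tr eta * s) * w ∈ D.adm Set.univ eta := by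
  refine ⟨w⁻¹, inv_mem hw, .single ⟨w⁻¹ * (tr eta * s * (tr eta)⁻¹) * w, ?_, ?_, hlen⟩⟩
  · refine ⟨j, trivial, 1, fun x => ?_⟩
    change w⁻¹ ((tr eta * s * (tr eta)⁻¹) (w x)) = x - (cr j x - (1 : ℤ)) • rt j
    change w.symm _ = _
    rw [AffineEquiv.symm_apply_eq, sub_eq_add_neg, ← neg_smul, finW_add_smul hw, hrt, ← hcr]
    have h : (tr eta)⁻¹ (w x) = w x - eta := by
      change (tr eta).symm _ = _
      rw [AffineEquiv.symm_apply_eq, tr_apply, add_sub_cancel]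
    change eta + s ((tr eta)⁻¹ (w x)) = _
    rw [h, hs, map_sub, hη]
    push_cast
    module
  · rw [← conj_tr hw]
    have := refl_mul_self hs
    calc w⁻¹ * tr eta * w = w⁻¹ * tr eta * (s * s) * w := by rw [this, mul_one]
      _ = _ := by group

/-- `(w^M)⁻¹ t_η s w^M` is `η`-admissible for `w^M` a minimal length coset representative. -/
lemma conj_mem_adm_of_isMinRep {i : Fin 4} (hi : i = 0 ∨ i = 1)
    {s w : (Fin 3 → ℝ) ≃ᵃ[ℝ] (Fin 3 → ℝ)} (hs : ∀ x, s x = x - cr i x • rt i)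
    (hw : D.IsMinRep {i} w) : w⁻¹ * (tr eta * s) * w ∈ D.adm Set.univ eta := by
  have hlt := hw.2 i ⟨hi, rfl⟩ s hs
  have hη : cr i eta = 1 := by rcases hi with rfl | rfl <;> simp [eta]; norm_num
  have hsw : ∀ x, (s * w) x = w x - cr i (w x) • rt i := fun x => hs (w x)
  obtain ⟨d₁, d₂, h | h⟩ := finW_cases hw.1
  · have hinv := h.inv.2.2
    obtain ⟨h₁, h₂, h⟩ := h
    rw [len_diag w 0 0 d₁ d₂ h₁ h₂ (by intro x; simp [h])] at hlt
    rcases hi with rfl | rfl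
    · rw [len_swap (s * w) 0 0 d₂ d₁ h₂ h₁ (by intro x; simp [hsw, h, rt])] at hlt
      obtain rfl : d₁ = 0 := by omega
      have hlen : D.len Set.univ (w⁻¹ * (tr eta * s) * w) < D.len Set.univ (tr (w⁻¹ eta)) := by
        rw [len_swap (w⁻¹ * (tr eta * s) * w) 2 (1 + 2 * d₂) d₂ d₂ h₂ h₂
            (by intro x; simp [hs, hinv, h, eta, rt]; ring),
          len_diag (tr (w⁻¹ eta)) 2 (1 + 2 * d₂) 0 0 (Or.inl rfl) (Or.inl rfl)
            (by intro x; simp [hinv, eta])]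
        omega
      rcases h₂ with rfl | rfl
      · refine conj_mem_adm (j := 0) hw.1 hs hη (fun x => by simp [h]) ?_ hlen
        ext k; fin_cases k <;> simp [h, rt]
      · refine conj_mem_adm (j := 3) hw.1 hs hη (fun x => by simp [h]; ring) ?_ hlen
        ext k; fin_cases k <;> simp [h, rt]; norm_num
    · rw [len_diag (s * w) 0 0 d₁ (-1 - d₂) h₁ (by omega)
        (by intro x; simp [hsw, h, rt]; ring)] at hlt
      obtain rfl : d₂ = 0 := by omega
      have hlen : D.len Set.univ (w⁻¹ * (tr eta * s) * w) < D.len Set.univ (tr (w⁻¹ eta)) := by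
        rw [len_diag (w⁻¹ * (tr eta * s) * w) (2 * (1 + 2 * d₁)) 1 0 (-1) (by simp) (by simp)
            (by intro x; rcases h₁ with rfl | rfl <;> simp [hs, hinv, h, eta, rt] <;>
              (try constructor) <;> ring),
          len_diag (tr (w⁻¹ eta)) (2 * (1 + 2 * d₁)) 1 0 0 (Or.inl rfl) (Or.inl rfl)
            (by intro x; simp [hinv, eta]; ring)]
        omega
      refine conj_mem_adm (j := 1) hw.1 hs hη (fun x => by simp [h]) ?_ hlen
      ext k; fin_cases k <;> simp [h, rt]
  · have hinv := h.inv.2.2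
    obtain ⟨h₁, h₂, h⟩ := h
    rw [len_swap w 0 0 d₁ d₂ h₁ h₂ (by intro x; simp [h])] at hlt
    rcases hi with rfl | rfl
    · rw [len_diag (s * w) 0 0 d₂ d₁ h₂ h₁ (by intro x; simp [hsw, h, rt])] at hlt
      obtain rfl : d₂ = -1 := by omega
      have hlen : D.len Set.univ (w⁻¹ * (tr eta * s) * w) < D.len Set.univ (tr (w⁻¹ eta)) := by
        rw [len_swap (w⁻¹ * (tr eta * s) * w) (-1) (2 * (1 + 2 * d₁)) (-1 - d₁) (-1 - d₁)
            (by omega) (by omega)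
            (by intro x; rcases h₁ with rfl | rfl <;> simp [hs, hinv, h, eta, rt] <;>
              (try constructor) <;> ring),
          len_diag (tr (w⁻¹ eta)) (-1) (2 * (1 + 2 * d₁)) 0 0 (Or.inl rfl) (Or.inl rfl)
            (by intro x; simp [hinv, eta]; constructor <;> ring)]
        omega
      rcases h₁ with rfl | rfl
      · refine conj_mem_adm (j := 3) hw.1 hs hη (fun x => by simp [h]; ring) ?_ hlen
        ext k; fin_cases k <;> simp [h, rt]; norm_num
      · refine conj_mem_adm (j := 0) hw.1 hs hη (fun x => by simp [h]; ring) ?_ hlen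
        ext k; fin_cases k <;> simp [h, rt] <;> norm_num
    · rw [len_swap (s * w) 0 0 d₁ (-1 - d₂) h₁ (by omega)
        (by intro x; simp [hsw, h, rt]; ring)] at hlt
      obtain rfl : d₂ = 0 := by omega
      have hlen : D.len Set.univ (w⁻¹ * (tr eta * s) * w) < D.len Set.univ (tr (w⁻¹ eta)) := by
        rw [len_diag (w⁻¹ * (tr eta * s) * w) 1 (2 * (1 + 2 * d₁)) (-1) 0 (by simp) (by simp)
            (by intro x; rcases h₁ with rfl | rfl <;> simp [hs, hinv, h, eta, rt] <;>
              (try constructor) <;> ring),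
          len_diag (tr (w⁻¹ eta)) 1 (2 * (1 + 2 * d₁)) 0 0 (Or.inl rfl) (Or.inl rfl)
            (by intro x; simp [hinv, eta]; ring)]
        omega
      refine conj_mem_adm (j := 2) hw.1 hs hη (fun x => by simp [h]) ?_ hlen
      ext k; fin_cases k <;> simp [h, rt]

lemma len_singleton_tr {i : Fin 4} {v : Fin 3 → ℝ} {n : ℤ} (hv : cr i v = n) :
    D.len {i} (tr v) = n.natAbs := by
  refine len_singleton i _ n fun x h0 h1 => ?_
  rw [tr_apply, map_add, hv]
  constructor <;> linarith

section Levi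

variable {i : Fin 4} {s : (Fin 3 → ℝ) ≃ᵃ[ℝ] (Fin 3 → ℝ)}

lemma cr_refl (hs : ∀ x, s x = x - cr i x • rt i) (x : Fin 3 → ℝ) : cr i (s x) = -cr i x := by
  rw [hs, map_sub, map_smul, cr_rt_self, smul_eq_mul]; ring

lemma len_tr_mul_refl (hs : ∀ x, s x = x - cr i x • rt i) (hη : cr i eta = 1) :
    D.len {i} (tr eta * s) = 0 := by
  refine len_singleton i _ 0 fun x h0 h1 => ?_
  change _ < cr i (eta + s x) ∧ cr i (eta + s x) < _
  rw [map_add, hη, cr_refl hs]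
  push_cast
  constructor <;> linarith

lemma tr_mul_refl_mem_adm (hs : ∀ x, s x = x - cr i x • rt i) (hη : cr i eta = 1) :
    tr eta * s ∈ D.adm {i} eta := by
  refine ⟨1, one_mem _, .single ⟨tr eta * s * (tr eta)⁻¹, ⟨i, rfl, 1, fun x => ?_⟩, ?_, ?_⟩⟩
  · have h : (tr eta)⁻¹ x = x - eta := by
      change (tr eta).symm _ = _
      rw [AffineEquiv.symm_apply_eq, tr_apply, add_sub_cancel]
    change eta + s ((tr eta)⁻¹ x) = x - (cr i x - (1 : ℤ)) • rt i
    rw [h, hs, map_sub, hη]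
    push_cast
    module
  · change tr eta = _
    have := refl_mul_self hs
    calc tr eta = tr eta * (s * s) := by rw [this, mul_one]
      _ = _ := by group
  · change _ < D.len {i} (tr eta)
    rw [len_tr_mul_refl hs hη, len_singleton_tr (n := 1) (by simpa using hη)]
    decide

/-- An affine reflection of `M` carrying `t_v`, `⟨v, α^∨⟩ = ±1`, to an element of length zero is
the reflection in the hyperplane between the base alcove and its translate by `v`. -/
lemma affRefl_index {r : (Fin 3 → ℝ) ≃ᵃ[ℝ] (Fin 3 → ℝ)} {m n : ℤ} {v : Fin 3 → ℝ}
    (hr : ∀ x, r x = x - (cr i x - m) • rt i) (hv : cr i v = n)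
    (hlen : D.len {i} (r * tr v) = 0) : n + 1 = 2 * m := by
  rw [len_singleton i _ (2 * m - n - 1) fun x h0 h1 => ?_] at hlen
  · omega
  · change _ < cr i (r (v + x)) ∧ cr i (r (v + x)) < _
    rw [hr, map_sub, map_smul, cr_rt_self, map_add, hv]
    push_cast [smul_eq_mul]
    constructor <;> linarith

lemma adm_singleton (hs : ∀ x, s x = x - cr i x • rt i) (hη : cr i eta = 1)
    {y : (Fin 3 → ℝ) ≃ᵃ[ℝ] (Fin 3 → ℝ)} (hy : y ∈ D.adm {i} eta) :
    y = tr eta ∨ y = tr (s eta) ∨ y = tr eta * s := by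
  have hsη : cr i (s eta) = -1 := by rw [cr_refl hs, hη]
  obtain ⟨w, hw, hy⟩ := hy
  induction hy using Relation.ReflTransGen.head_induction_on with
  | refl =>
    rcases finW_singleton hs hw with rfl | rfl
    · exact Or.inl rfl
    · exact Or.inr (Or.inl rfl)
  | @head a b hab _ ih =>
    obtain ⟨r, ⟨j, hj, m, hr⟩, hb, hlt⟩ := hab
    rw [Set.mem_singleton_iff.1 hj] at hr
    change ∀ x, r x = x - (cr i x - m) • rt i at hr
    have ha : a = r * b := by rw [hb, ← mul_assoc, affRefl_mul_self hr, one_mul]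
    have key : ∀ (v : Fin 3 → ℝ) (n : ℤ), cr i v = n → n.natAbs = 1 → b = tr v →
        n + 1 = 2 * m ∧ ∀ x, a x = v + x - (cr i (v + x) - m) • rt i := by
      rintro v n hv hn rfl
      rw [len_singleton_tr hv, hn, ha] at hlt
      refine ⟨affRefl_index hr hv (by omega), fun x => ?_⟩
      rw [ha]
      exact hr (v + x)
    refine Or.inr (Or.inr (AffineEquiv.ext fun x => ?_))
    change a x = eta + s x
    rcases ih with h | h | h
    · obtain ⟨hm, h⟩ := key _ 1 (by simpa using hη) rfl h
      obtain rfl : m = 1 := by omega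
      rw [h, map_add, hη, hs]
      push_cast
      module
    · obtain ⟨hm, h⟩ := key _ (-1) (by simpa using hsη) rfl h
      obtain rfl : m = 0 := by omega
      rw [h, map_add, hsη, hs, hs, hη]
      push_cast
      module
    · rw [h, len_tr_mul_refl hs hη] at hlt
      omega

lemma refl_ne_tr (hs : ∀ x, s x = x - cr i x • rt i) (v : Fin 3 → ℝ) : s ≠ tr v := by
  intro h
  have h0 : cr i (s 0) = cr i (tr v 0) := by rw [h]
  have h1 : cr i (s (rt i)) = cr i (tr v (rt i)) := by rw [h]
  rw [cr_refl hs, tr_apply] at h0 h1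
  simp only [map_add, map_zero, cr_rt_self] at h0 h1
  linarith

lemma tr_mul_refl_ne_tr (hs : ∀ x, s x = x - cr i x • rt i) (u v : Fin 3 → ℝ) :
    tr u * s ≠ tr v := by
  intro h
  refine refl_ne_tr hs (v - u) (AffineEquiv.ext fun x => ?_)
  have h : u + s x = v + x := congrArg (fun g => g x) h
  rw [tr_apply, sub_add_eq_add_sub, ← h, add_sub_cancel_left]

end Levi

end GSp4

/-- For `G = GSp₄`, `M ≅ GL₁ × GL₂` the proper Levi corresponding to a
simple root `α_i`, `s` the nontrivial reflection of `W_M` and `w^M ∈ W^M`, the element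
`(w^M)⁻¹ t_η s w^M` lies in `(w^M)⁻¹ Adm_M(η) w^M ⊆ Adm(η)` and is the unique element of
`(w^M)⁻¹ Adm_M(η) w^M` not contained in
`(w^M)⁻¹ Adm_T(η) w^M ∪ (s w^M)⁻¹ Adm_T(η) (s w^M)`,
where `Adm_T(η) = {t_{w(η)} : w ∈ W}`. -/
theorem gsp4_parabolic_shape (i : Fin 4) (hi : i ∈ ({0, 1} : Set (Fin 4)))
    (s : (Fin 3 → ℝ) ≃ᵃ[ℝ] (Fin 3 → ℝ)) (hs : ∀ x, s x = x - cr i x • rt i)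
    (wM : (Fin 3 → ℝ) ≃ᵃ[ℝ] (Fin 3 → ℝ)) (hwM : D.IsMinRep {i} wM) :
    tr eta * s ∈ D.adm {i} eta ∧
    wM⁻¹ * (tr eta * s) * wM ∈ D.adm Set.univ eta ∧
    (¬ ∃ w ∈ D.finW Set.univ,
        wM⁻¹ * (tr eta * s) * wM = wM⁻¹ * tr (w eta) * wM ∨
        wM⁻¹ * (tr eta * s) * wM = (s * wM)⁻¹ * tr (w eta) * (s * wM)) ∧
    ∀ y ∈ D.adm {i} eta,
      (¬ ∃ w ∈ D.finW Set.univ,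
          wM⁻¹ * y * wM = wM⁻¹ * tr (w eta) * wM ∨
          wM⁻¹ * y * wM = (s * wM)⁻¹ * tr (w eta) * (s * wM)) →
      wM⁻¹ * y * wM = wM⁻¹ * (tr eta * s) * wM := by
  have hη : cr i eta = 1 := by rcases hi with rfl | rfl <;> simp [eta]; norm_num
  have hss := inv_eq_of_mul_eq_one_left (refl_mul_self hs)
  have hsW := refl_mem_finW hs Set.univ trivial
  refine ⟨tr_mul_refl_mem_adm hs hη, conj_mem_adm_of_isMinRep hi hs hwM, ?_, ?_⟩
  · rintro ⟨w, -, h | h⟩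
    · exact tr_mul_refl_ne_tr hs _ _ (mul_left_cancel (mul_right_cancel h))
    · have h : wM⁻¹ * (tr eta * s) * wM = wM⁻¹ * (s⁻¹ * tr (w eta) * s) * wM := by
        rw [h]; group
      refine tr_mul_refl_ne_tr hs _ _ ((mul_left_cancel (mul_right_cancel h)).trans
        (conj_tr hsW _))
  · intro y hy hne
    rcases adm_singleton hs hη hy with rfl | rfl | rfl
    · exact absurd ⟨1, one_mem _, Or.inl rfl⟩ hne
    · exact absurd ⟨s, hsW, Or.inl rfl⟩ hne
    · rfl
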